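/- Let V be a countable set and (V,E) an acyclic digraph whose induced partial order is ≤. Then the set D = { f ∈ ℓ¹(V) : there exists a finitely decomposable flow Q on (V,E) with div Q = f } is convex and closed in the norm topology of ℓ¹(V). -/

import Mathlib

open scoped BigOperators

variable {V : Type*}

/-- A directed path in the digraph `(V, E)`: a nonempty list of vertices whose
consecutive pairs are directed edges. -/
def IsDipath (E : Set (V × V)) (l : List V) : Prop :=
  l ≠ [] ∧ l.Chain' (fun a b => (a, b) ∈ E)

/-- The list of directed edges of a path. -/
def pathEdges (l : List V) : List (V × V) := l.zip l.tail

/-- The unit flow `Q_γ` along a path: `1` on the edges of the path and `0` elsewhere. -/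
noncomputable def pathFlow (l : List V) : V × V → ℝ :=
  Set.indicator {e | e ∈ pathEdges l} 1

/-- A flow on the digraph `(V, E)`: nonnegative and supported on `E`. -/
def IsFlow (E : Set (V × V)) (Q : V × V → ℝ) : Prop :=
  (∀ e, 0 ≤ Q e) ∧ ∀ e, e ∉ E → Q e = 0

/-- The divergence of a flow at a vertex. -/
noncomputable def divergence (Q : V × V → ℝ) (x : V) : ℝ :=
  (∑' y, Q (x, y)) - ∑' y, Q (y, x)

/-- A relation is acyclic if it has no directed cycles. -/
def AcyclicRel (r : V → V → Prop) : Prop := ∀ x, ¬ Relation.TransGen r x x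

/-- The edge relation of a digraph. -/
def edgeRel (E : Set (V × V)) : V → V → Prop := fun a b => (a, b) ∈ E

/-- The partial order induced by an acyclic digraph: `x ≤ y` iff `x = y` or there is
a directed path from `x` to `y`. -/
def inducedLE (E : Set (V × V)) : V → V → Prop :=
  Relation.ReflTransGen (edgeRel E)

/-- A finitely decomposable flow: a pointwise sum `∑ₙ qₙ Q_{γₙ}` over finite
self-avoiding directed paths with summable nonnegative weights. -/
def FinDecomposable (E : Set (V × V)) (Q : V × V → ℝ) : Prop :=
  ∃ (γ : ℕ → List V) (q : ℕ → ℝ),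
    (∀ n, IsDipath E (γ n)) ∧ (∀ n, (γ n).Nodup) ∧ (∀ n, 0 ≤ q n) ∧ Summable q ∧
    ∀ e, Q e = ∑' n, q n * pathFlow (γ n) e

/-- A probability measure on a countable set, as a nonnegative function of total sum `1`. -/
def IsProb (μ : V → ℝ) : Prop := (∀ x, 0 ≤ μ x) ∧ HasSum μ 1

/-- A coupling of `μ₁` and `μ₂`: a probability on `V × V` with the given marginals. -/
def IsCoupling (μ₁ μ₂ : V → ℝ) (ρ : V × V → ℝ) : Prop :=
  (∀ p, 0 ≤ ρ p) ∧ (∀ x, HasSum (fun y => ρ (x, y)) (μ₁ x)) ∧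
    ∀ y, HasSum (fun x => ρ (x, y)) (μ₂ y)

/-- Stochastic domination: `∑ f μ₁ ≤ ∑ f μ₂` for every bounded increasing `f`. -/
def StochDom (le : V → V → Prop) (μ₁ μ₂ : V → ℝ) : Prop :=
  ∀ f : V → ℝ, (∃ C, ∀ x, |f x| ≤ C) → (∀ x y, le x y → f x ≤ f y) →
    ∑' x, f x * μ₁ x ≤ ∑' x, f x * μ₂ x

/-- Finite-case divergence. -/
noncomputable def divergenceF [Fintype V] (Q : V × V → ℝ) (x : V) : ℝ :=
  (∑ y, Q (x, y)) - ∑ y, Q (y, x)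

/-- Probability measure on a finite set. -/
def IsProbF [Fintype V] (μ : V → ℝ) : Prop := (∀ x, 0 ≤ μ x) ∧ ∑ x, μ x = 1

/-- Coupling on a finite set. -/
def IsCouplingF [Fintype V] (μ₁ μ₂ : V → ℝ) (ρ : V × V → ℝ) : Prop :=
  (∀ p, 0 ≤ ρ p) ∧ (∀ x, ∑ y, ρ (x, y) = μ₁ x) ∧ ∀ y, ∑ x, ρ (x, y) = μ₂ y

/-- Stochastic domination on a finite set. -/
def StochDomF [Fintype V] (le : V → V → Prop) (μ₁ μ₂ : V → ℝ) : Prop :=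
  ∀ f : V → ℝ, (∀ x y, le x y → f x ≤ f y) → ∑ x, f x * μ₁ x ≤ ∑ x, f x * μ₂ x

/-- The cost of a path: the sum of the weights of its edges. -/
noncomputable def pathCost (w : V × V → ℝ) (l : List V) : ℝ := ((pathEdges l).map w).sum

/-- The geodesic cost associated to a weight function on a digraph. -/
noncomputable def geoCost (E : Set (V × V)) (w : V × V → ℝ) (x y : V) : ℝ :=
  sInf {r | ∃ l, IsDipath E l ∧ l.head? = some x ∧ l.getLast? = some y ∧ pathCost w l = r}

/-! ### Paths -/

theorem pathFlow_cons_cons {u w : V} {t : List V} (h : (u :: w :: t).Nodup) (e : V × V) :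
    pathFlow (u :: w :: t) e = Set.indicator {(u, w)} 1 e + pathFlow (w :: t) e := by
  classical
  have hu : u ∉ w :: t := (List.nodup_cons.1 h).1
  have hcons : pathEdges (u :: w :: t) = (u, w) :: pathEdges (w :: t) := rfl
  have hnot : (u, w) ∉ pathEdges (w :: t) := fun hm => hu (List.of_mem_zip hm).1
  by_cases he : e = (u, w)
  · subst he
    simp [pathFlow, hcons, hnot]
  · simp [pathFlow, hcons, he, Set.indicator_apply]

theorem pathFlow_singleton (u : V) (e : V × V) : pathFlow [u] e = 0 := by
  simp [pathFlow, pathEdges]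

theorem pathFlow_nonneg (l : List V) (e : V × V) : 0 ≤ pathFlow l e :=
  Set.indicator_nonneg (fun _ _ => zero_le_one) e

theorem IsDipath.pathEdges_subset {E : Set (V × V)} :
    ∀ {l : List V}, IsDipath E l → ∀ e ∈ pathEdges l, e ∈ E
  | [], h, _, _ => absurd rfl h.1
  | [u], _, e, he => by simp [pathEdges] at he
  | u :: w :: t, h, e, he => by
    have hc := List.isChain_cons_cons.1 h.2
    rcases List.mem_cons.1 (show e ∈ (u, w) :: pathEdges (w :: t) from he) with rfl | he
    · exact hc.1
    · exact IsDipath.pathEdges_subset ⟨List.cons_ne_nil _ _, hc.2⟩ e he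

theorem hasSum_pathFlow_out (x : V) : ∀ l : List V, l ≠ [] → l.Nodup →
    HasSum (fun y => pathFlow l (x, y))
      (Set.indicator {y | y ∈ l} 1 x - Set.indicator {y | l.getLast? = some y} 1 x)
  | [], h, _ => absurd rfl h
  | [u], _, _ => by
    classical
    simp only [pathFlow_singleton]
    convert hasSum_zero using 1
    simp [Set.indicator_apply, eq_comm]
  | u :: w :: t, _, hl => by
    classical
    have ih := hasSum_pathFlow_out x (w :: t) (List.cons_ne_nil _ _) (List.nodup_cons.1 hl).2
    simp only [pathFlow_cons_cons hl]
    have hu : u ∉ w :: t := (List.nodup_cons.1 hl).1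
    have h1 : HasSum (fun y => Set.indicator {(u, w)} (1 : V × V → ℝ) (x, y))
        (if x = u then 1 else 0) := by
      convert hasSum_ite_eq w (if x = u then (1 : ℝ) else 0) using 2 with y
      by_cases hx : x = u <;> by_cases hy : y = w <;> simp [hx, hy]
    convert h1.add ih using 1
    simp only [List.getLast?_cons_cons]
    by_cases hx : x = u
    · subst hx
      simp only [List.mem_cons, not_or] at hu
      simp [hu, Set.indicator_apply, sub_eq_add_neg]
    · simp [hx, Set.indicator_apply]

theorem hasSum_pathFlow_in (x : V) : ∀ l : List V, l ≠ [] → l.Nodup →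
    HasSum (fun y => pathFlow l (y, x))
      (Set.indicator {y | y ∈ l} 1 x - Set.indicator {y | l.head? = some y} 1 x)
  | [], h, _ => absurd rfl h
  | [u], _, _ => by
    classical
    simp only [pathFlow_singleton]
    convert hasSum_zero using 1
    simp [Set.indicator_apply, eq_comm]
  | u :: w :: t, _, hl => by
    classical
    have ih := hasSum_pathFlow_in x (w :: t) (List.cons_ne_nil _ _) (List.nodup_cons.1 hl).2
    simp only [pathFlow_cons_cons hl]
    have hu : u ∉ w :: t := (List.nodup_cons.1 hl).1
    have h1 : HasSum (fun y => Set.indicator {(u, w)} (1 : V × V → ℝ) (y, x))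
        (if x = w then 1 else 0) := by
      convert hasSum_ite_eq u (if x = w then (1 : ℝ) else 0) using 2 with y
      by_cases hx : x = w <;> by_cases hy : y = u <;> simp [hx, hy]
    convert h1.add ih using 1
    by_cases hx : x = u
    · subst hx
      have hxw : x ≠ w := fun h => hu (h ▸ List.mem_cons_self)
      simp only [List.mem_cons, not_or] at hu
      simp [hxw, hu.2]
    · by_cases hxw : x = w
      · subst hxw
        simp [hx]
      · simp [hx, hxw, Set.indicator_apply]

/-- Tonelli's theorem for sums of nonnegative functions, in terms of `HasSum`. -/
theorem hasSum_tsum_of_nonneg {α β : Type*} {F : α → β → ℝ} {c : α → ℝ}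
    (h0 : ∀ a b, 0 ≤ F a b) (hF : ∀ a, HasSum (F a) (c a)) (hc : Summable c) :
    (∀ b, Summable fun a => F a b) ∧ HasSum (fun b => ∑' a, F a b) (∑' a, c a) := by
  have hs : Summable fun p : α × β => F p.1 p.2 :=
    (summable_prod_of_nonneg fun p => h0 p.1 p.2).2
      ⟨fun a => (hF a).summable, by simpa only [(hF _).tsum_eq] using hc⟩
  have hs' : Summable fun p : β × α => F p.2 p.1 := (Equiv.prodComm β α).summable_iff.2 hs
  have hb : ∀ b, Summable fun a => F a b := fun b => hs'.prod_factor b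
  refine ⟨hb, ?_⟩
  have e1 : ∑' p : α × β, F p.1 p.2 = ∑' a, c a :=
    (hs.hasSum.prod_fiberwise hF).tsum_eq.symm
  have h2 : HasSum (fun p : β × α => F p.2 p.1) (∑' a, c a) :=
    e1 ▸ (Equiv.prodComm β α).hasSum_iff.2 hs.hasSum
  exact h2.prod_fiberwise fun b => (hb b).hasSum

/-- The divergence of a countable superposition of paths is the superposition of the differences
between the indicators of their starting and end points. -/
theorem divergence_tsum_pathFlow {γ : ℕ → List V} {q : ℕ → ℝ} (hne : ∀ n, γ n ≠ [])
    (hnd : ∀ n, (γ n).Nodup) (h0 : ∀ n, 0 ≤ q n) (hq : Summable q) (x : V) :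
    divergence (fun e => ∑' n, q n * pathFlow (γ n) e) x =
      ∑' n, q n * Set.indicator {y | (γ n).head? = some y} 1 x -
        ∑' n, q n * Set.indicator {y | (γ n).getLast? = some y} 1 x := by
  have ind : ∀ S : ℕ → Set V, Summable fun n => q n * (S n).indicator 1 x := fun S =>
    hq.of_nonneg_of_le
      (fun n => mul_nonneg (h0 n) (Set.indicator_nonneg (fun _ _ => zero_le_one) x))
      (fun n => mul_le_of_le_one_right (h0 n)
        (Set.indicator_le_self' (fun _ _ => zero_le_one) x))
  have hout : ∑' y, ∑' n, q n * pathFlow (γ n) (x, y) =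
      ∑' n, (q n * Set.indicator {y | y ∈ γ n} 1 x -
        q n * Set.indicator {y | (γ n).getLast? = some y} 1 x) :=
    (hasSum_tsum_of_nonneg (F := fun n y => q n * pathFlow (γ n) (x, y))
      (c := fun n => q n * Set.indicator {y | y ∈ γ n} 1 x -
        q n * Set.indicator {y | (γ n).getLast? = some y} 1 x)
      (fun n y => mul_nonneg (h0 n) (pathFlow_nonneg _ _))
      (fun n => by
        simpa only [mul_sub] using (hasSum_pathFlow_out x (γ n) (hne n) (hnd n)).mul_left (q n))
      ((ind _).sub (ind _))).2.tsum_eq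
  have hin : ∑' y, ∑' n, q n * pathFlow (γ n) (y, x) =
      ∑' n, (q n * Set.indicator {y | y ∈ γ n} 1 x -
        q n * Set.indicator {y | (γ n).head? = some y} 1 x) :=
    (hasSum_tsum_of_nonneg (F := fun n y => q n * pathFlow (γ n) (y, x))
      (c := fun n => q n * Set.indicator {y | y ∈ γ n} 1 x -
        q n * Set.indicator {y | (γ n).head? = some y} 1 x)
      (fun n y => mul_nonneg (h0 n) (pathFlow_nonneg _ _))
      (fun n => by
        simpa only [mul_sub] using (hasSum_pathFlow_in x (γ n) (hne n) (hnd n)).mul_left (q n))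
      ((ind _).sub (ind _))).2.tsum_eq
  rw [divergence, hout, hin, (ind _).tsum_sub (ind _), (ind _).tsum_sub (ind _)]
  ring

theorem edgeRel_isChain_nodup {E : Set (V × V)} (hacyc : AcyclicRel (edgeRel E)) {l : List V}
    (hl : l.IsChain (edgeRel E)) : l.Nodup := by
  have h : l.IsChain (Relation.TransGen (edgeRel E)) := hl.imp fun _ _ => Relation.TransGen.single
  exact h.pairwise.imp fun {a b} hab (e : a = b) => hacyc a (by rwa [← e] at hab)

/-! ### Transport plans along a relation -/

/-- A transport plan of finite mass from `O` to `I` that only moves mass along `r`. -/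
structure IsPlan (r : V → V → Prop) (O I : V → ℝ) (ρ : V × V → ℝ) : Prop where
  coupling : IsCoupling O I ρ
  rel_of_ne_zero : ∀ p, ρ p ≠ 0 → r p.1 p.2
  summable_left : Summable O

namespace IsPlan

variable {r : V → V → Prop} {O I : V → ℝ} {ρ : V × V → ℝ}

theorem nonneg (h : IsPlan r O I ρ) (p : V × V) : 0 ≤ ρ p := h.coupling.1 p

theorem hasSum_row (h : IsPlan r O I ρ) (x : V) : HasSum (fun y => ρ (x, y)) (O x) :=
  h.coupling.2.1 x

theorem hasSum_col (h : IsPlan r O I ρ) (y : V) : HasSum (fun x => ρ (x, y)) (I y) :=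
  h.coupling.2.2 y

theorem summable_right (h : IsPlan r O I ρ) : Summable I := by
  have := (hasSum_tsum_of_nonneg (F := fun x y => ρ (x, y)) (fun _ _ => h.nonneg _)
    h.hasSum_row h.summable_left).2.summable
  simpa only [(h.hasSum_col _).tsum_eq] using this

theorem swap (h : IsPlan r O I ρ) : IsPlan (flip r) I O (ρ ∘ Prod.swap) :=
  ⟨⟨fun _ => h.nonneg _, h.hasSum_col, h.hasSum_row⟩, fun p hp => h.rel_of_ne_zero p.swap hp,
    h.summable_right⟩

theorem summable (h : IsPlan r O I ρ) : Summable ρ :=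
  (summable_prod_of_nonneg h.nonneg).2
    ⟨fun x => (h.hasSum_row x).summable,
      by simpa only [(h.hasSum_row _).tsum_eq] using h.summable_left⟩

theorem left_nonneg (h : IsPlan r O I ρ) (x : V) : 0 ≤ O x :=
  (h.hasSum_row x).nonneg fun _ => h.nonneg _

theorem right_nonneg (h : IsPlan r O I ρ) (x : V) : 0 ≤ I x := h.swap.left_nonneg x

theorem le_left (h : IsPlan r O I ρ) (p : V × V) : ρ p ≤ O p.1 :=
  le_hasSum (h.hasSum_row p.1) p.2 fun _ _ => h.nonneg _

theorem le_right (h : IsPlan r O I ρ) (p : V × V) : ρ p ≤ I p.2 := h.swap.le_left p.swap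

open Classical in
theorem hasSum_fst_eq (h : IsPlan r O I ρ) (x : V) :
    HasSum (fun p : V × V => ρ p * if p.1 = x then 1 else 0) (O x) := by
  have hs : Summable fun p : V × V => ρ p * if p.1 = x then 1 else 0 :=
    h.summable.of_nonneg_of_le (fun p => by split_ifs <;> simp [h.nonneg p])
      (fun p => by split_ifs <;> simp [h.nonneg p])
  have h1 : HasSum (fun a => if a = x then O x else 0)
      (∑' p : V × V, ρ p * if p.1 = x then 1 else 0) := by
    refine hs.hasSum.prod_fiberwise fun a => ?_
    by_cases ha : a = x
    · subst ha
      simpa using h.hasSum_row a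
    · simp [ha, hasSum_zero]
  rw [(hasSum_ite_eq x (O x)).unique h1]
  exact hs.hasSum

open Classical in
theorem hasSum_snd_eq (h : IsPlan r O I ρ) (x : V) :
    HasSum (fun p : V × V => ρ p * if p.2 = x then 1 else 0) (I x) :=
  (Equiv.prodComm V V).hasSum_iff.1 (h.swap.hasSum_fst_eq x)

theorem smul_add_smul {O' I' : V → ℝ} {ρ' : V × V → ℝ} (h : IsPlan r O I ρ)
    (h' : IsPlan r O' I' ρ') {a b : ℝ} (ha : 0 ≤ a) (hb : 0 ≤ b) :
    IsPlan r (fun x => a * O x + b * O' x) (fun x => a * I x + b * I' x)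
      (fun p => a * ρ p + b * ρ' p) := by
  refine ⟨⟨fun p => ?_, fun x => ?_, fun x => ?_⟩, fun p hp => ?_, ?_⟩
  · have := h.nonneg p
    have := h'.nonneg p
    positivity
  · exact ((h.hasSum_row x).mul_left a).add ((h'.hasSum_row x).mul_left b)
  · exact ((h.hasSum_col x).mul_left a).add ((h'.hasSum_col x).mul_left b)
  · by_cases h0 : ρ p = 0
    · refine h'.rel_of_ne_zero p fun h0' => hp ?_
      simp [h0, h0']
    · exact h.rel_of_ne_zero p h0
  · exact (h.summable_left.mul_left a).add (h'.summable_left.mul_left b)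

open Classical in
/-- Mass arriving at a vertex can be joined with mass departing from it, so that the common part of
the two marginals at this vertex is removed. -/
theorem exists_splice (h : IsPlan r O I ρ) (hirr : ∀ x, ¬ r x x)
    (htr : ∀ x y z, r x y → r y z → r x z) (v : V) :
    ∃ ρ', IsPlan r (fun x => O x - if x = v then min (O v) (I v) else 0)
      (fun x => I x - if x = v then min (O v) (I v) else 0) ρ' := by
  set m := min (O v) (I v)
  have hO0 := h.left_nonneg v
  have hI0 := h.right_nonneg v
  have hm0 : 0 ≤ m := le_min hO0 hI0
  obtain ⟨c, hc0, hcO, hcI, hcOI⟩ : ∃ c, 0 ≤ c ∧ c * O v ≤ 1 ∧ c * I v ≤ 1 ∧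
      c * O v * I v = m := by
    by_cases h0 : m = 0
    · exact ⟨0, le_rfl, by simp, by simp, by simp [h0]⟩
    have hmpos : 0 < m := lt_of_le_of_ne hm0 (Ne.symm h0)
    have hO : 0 < O v := hmpos.trans_le (min_le_left _ _)
    have hI : 0 < I v := hmpos.trans_le (min_le_right _ _)
    refine ⟨m / (O v * I v), by positivity, ?_, ?_, by field_simp⟩
    · rw [show m / (O v * I v) * O v = m / I v by field_simp]
      exact (div_le_one hI).2 (min_le_right _ _)
    · rw [show m / (O v * I v) * I v = m / O v by field_simp]
      exact (div_le_one hO).2 (min_le_left _ _)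
  have hvv : ρ (v, v) = 0 := by
    by_contra hne
    exact hirr v (h.rel_of_ne_zero _ hne)
  refine ⟨fun p => ρ p - (if p.2 = v then c * O v * ρ (p.1, v) else 0)
    - (if p.1 = v then c * I v * ρ (v, p.2) else 0) + c * (ρ (p.1, v) * ρ (v, p.2)),
    ⟨?_, ?_, ?_⟩, ?_, ?_⟩
  · rintro ⟨a, b⟩
    have h1 := h.nonneg (a, b)
    have h2 := h.nonneg (a, v)
    have h3 := h.nonneg (v, b)
    by_cases ha : a = v
    · subst ha
      by_cases hb : b = a
      · subst hb
        simp [hvv]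
      · simp only [hb, if_false, if_true, hvv]
        nlinarith
    · by_cases hb : b = v
      · subst hb
        simp only [ha, if_false, if_true, hvv]
        nlinarith
      · simp only [ha, hb, if_false]
        have : 0 ≤ c * (ρ (a, v) * ρ (v, b)) := by positivity
        linarith
  · intro a
    have h1 := (((h.hasSum_row a).sub (hasSum_ite_eq v (c * O v * ρ (a, v)))).sub
      (((h.hasSum_row v).mul_left (c * I v)).mul_left (if a = v then 1 else 0))).add
      (((h.hasSum_row v).mul_left (ρ (a, v))).mul_left c)
    have hval : O a - (if a = v then m else 0) =
        O a - c * O v * ρ (a, v) - (if a = v then 1 else 0) * (c * I v * O v) +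
        c * (ρ (a, v) * O v) := by
      by_cases ha : a = v
      · subst ha
        simp only [if_true]
        linear_combination hcOI
      · simp only [ha, if_false]
        ring
    simp only [hval]
    refine h1.congr_fun fun b => ?_
    by_cases ha : a = v <;> simp [ha]
  · intro b
    have h1 := (((h.hasSum_col b).sub
      (((h.hasSum_col v).mul_left (c * O v)).mul_left (if b = v then 1 else 0))).sub
      (hasSum_ite_eq v (c * I v * ρ (v, b)))).add
      (((h.hasSum_col v).mul_right (ρ (v, b))).mul_left c)
    have hval : I b - (if b = v then m else 0) =
        I b - (if b = v then 1 else 0) * (c * O v * I v) - c * I v * ρ (v, b) +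
        c * (I v * ρ (v, b)) := by
      by_cases hb : b = v
      · subst hb
        simp only [if_true]
        linear_combination hcOI
      · simp only [hb, if_false]
        ring
    simp only [hval]
    refine h1.congr_fun fun a => ?_
    by_cases hb : b = v <;> simp [hb]
  · rintro ⟨a, b⟩ hp
    by_contra hr
    have h1 : ρ (a, b) = 0 := by
      by_contra hne
      exact hr (h.rel_of_ne_zero _ hne)
    have h2 : ρ (a, v) * ρ (v, b) = 0 := by
      by_contra hne
      obtain ⟨hav, hvb⟩ := mul_ne_zero_iff.1 hne
      exact hr (htr _ _ _ (h.rel_of_ne_zero (a, v) hav) (h.rel_of_ne_zero (v, b) hvb))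
    refine hp ?_
    by_cases ha : a = v <;> by_cases hb : b = v
    · subst ha
      subst hb
      simp [hvv]
    · subst ha
      simp [hb, h1, hvv]
    · subst hb
      simp [ha, h1, hvv]
    · simp [ha, hb, h1, h2]
  · exact h.summable_left.sub (hasSum_ite_eq v m).summable

theorem exists_min_eq_zero_on (h : IsPlan r O I ρ) (hirr : ∀ x, ¬ r x x)
    (htr : ∀ x y z, r x y → r y z → r x z) (F : Finset V) :
    ∃ O' I' ρ', IsPlan r O' I' ρ' ∧ (∀ x, O' x - I' x = O x - I x) ∧ (∀ x, O' x ≤ O x) ∧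
      ∀ x ∈ F, min (O' x) (I' x) = 0 := by
  classical
  induction F using Finset.induction_on with
  | empty => exact ⟨O, I, ρ, h, fun _ => rfl, fun _ => le_rfl, by simp⟩
  | insert v F _ ih =>
    obtain ⟨O', I', ρ', h', hdiff, hle, hF⟩ := ih
    obtain ⟨ρ'', h''⟩ := h'.exists_splice hirr htr v
    refine ⟨_, _, ρ'', h'', fun x => ?_, fun x => ?_, fun x hx => ?_⟩
    · linarith [hdiff x]
    · have := le_min (h'.left_nonneg v) (h'.right_nonneg v)
      have := hle x
      split_ifs <;> linarith
    · by_cases hxv : x = v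
      · subst hxv
        simp only [if_true]
        rw [min_sub_sub_right, sub_self]
      · simpa [hxv] using hF x ((Finset.mem_insert.1 hx).resolve_left hxv)

theorem summable_min (h : IsPlan r O I ρ) : Summable fun x => min (O x) (I x) :=
  h.summable_left.of_nonneg_of_le (fun x => le_min (h.left_nonneg x) (h.right_nonneg x))
    (fun _ => min_le_left _ _)

/-- The common part of the two marginals of a plan along a strict order can be made as small as
desired without changing their difference. -/
theorem exists_tsum_min_le (h : IsPlan r O I ρ) (hirr : ∀ x, ¬ r x x)
    (htr : ∀ x y z, r x y → r y z → r x z) {ε : ℝ} (hε : 0 < ε) :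
    ∃ O' I' ρ', IsPlan r O' I' ρ' ∧ (∀ x, O' x - I' x = O x - I x) ∧
      ∑' x, min (O' x) (I' x) ≤ ε := by
  classical
  obtain ⟨F, hF⟩ := ((tendsto_tsum_compl_atTop_zero O).eventually (gt_mem_nhds hε)).exists
  obtain ⟨O', I', ρ', h', hdiff, hle, h0⟩ := h.exists_min_eq_zero_on hirr htr F
  refine ⟨O', I', ρ', h', hdiff, le_trans ?_ hF.le⟩
  rw [← h'.summable_min.sum_add_tsum_subtype_compl F, Finset.sum_eq_zero h0, zero_add]
  exact (h'.summable_min.subtype _).tsum_le_tsum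
    (fun x => (min_le_left _ _).trans (hle x)) (h.summable_left.subtype _)

end IsPlan

/-! ### Finitely decomposable flows and transport plans -/

/-- A finitely decomposable flow transports mass from the starting points of
its paths to their end points. -/
theorem FinDecomposable.exists_isPlan {E : Set (V × V)} {Q : V × V → ℝ}
    (hQ : FinDecomposable E Q) :
    ∃ O I ρ, IsPlan (Relation.TransGen (edgeRel E)) O I ρ ∧ ∀ x, divergence Q x = O x - I x := by
  classical
  obtain ⟨γ, q, hγ, hnd, h0, hq, hQe⟩ := hQ
  obtain rfl : Q = fun e => ∑' n, q n * pathFlow (γ n) e := funext hQe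
  set s : ℕ → V := fun n => (γ n).head (hγ n).1
  set t : ℕ → V := fun n => (γ n).getLast (hγ n).1
  have hs : ∀ n, (γ n).head? = some (s n) := fun n => List.head?_eq_some_head _
  have ht : ∀ n, (γ n).getLast? = some (t n) := fun n => List.getLast?_eq_some_getLast _
  have hst : ∀ n, s n ≠ t n → Relation.TransGen (edgeRel E) (s n) (t n) := fun n hne =>
    (Relation.reflTransGen_iff_eq_or_transGen.1
      (List.relationReflTransGen_of_exists_isChain (γ n) (hγ n).2 (hγ n).1)).resolve_left
      (Ne.symm hne)
  set w : ℕ → ℝ := fun n => if s n = t n then 0 else q n with hw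
  have hw0 : ∀ n, 0 ≤ w n := fun n => by
    simp only [hw]
    split_ifs
    exacts [le_rfl, h0 n]
  have hwq : ∀ n, w n ≤ q n := fun n => by
    simp only [hw]
    split_ifs
    exacts [h0 n, le_rfl]
  have hws : Summable w := hq.of_nonneg_of_le hw0 hwq
  have ind : ∀ {v : ℕ → ℝ}, (∀ n, 0 ≤ v n) → Summable v → ∀ P : ℕ → Prop,
      Summable fun n => v n * if P n then 1 else 0 := fun hv hvs P =>
    hvs.of_nonneg_of_le (fun n => by split_ifs <;> simp [hv n])
      (fun n => by split_ifs <;> simp [hv n])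
  have hite : ∀ (c : ℝ) (P R : Prop) [Decidable P] [Decidable R], 0 ≤ c →
      0 ≤ c * (if P then 1 else 0) * (if R then 1 else 0) := fun c P R _ _ hc => by
    split_ifs <;> simp [hc]
  refine ⟨fun x => ∑' n, w n * (if s n = x then 1 else 0),
    fun x => ∑' n, w n * (if t n = x then 1 else 0),
    fun p => ∑' n, w n * (if s n = p.1 then 1 else 0) * (if t n = p.2 then 1 else 0),
    ⟨⟨fun p => tsum_nonneg fun n => hite _ _ _ (hw0 n), fun x => ?_, fun y => ?_⟩,
      fun p hp => ?_, ?_⟩, fun x => ?_⟩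
  · refine (hasSum_tsum_of_nonneg
      (F := fun n y => w n * (if s n = x then 1 else 0) * (if t n = y then 1 else 0))
      (fun n y => hite _ _ _ (hw0 n)) (fun n => ?_) (ind hw0 hws _)).2
    refine (hasSum_ite_eq (t n) (w n * (if s n = x then 1 else 0))).congr_fun fun y => ?_
    by_cases h : t n = y
    · simp [h]
    · simp [h, Ne.symm h]
  · refine (hasSum_tsum_of_nonneg
      (F := fun n x => w n * (if s n = x then 1 else 0) * (if t n = y then 1 else 0))
      (fun n y => hite _ _ _ (hw0 n)) (fun n => ?_) (ind hw0 hws _)).2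
    refine (hasSum_ite_eq (s n) (w n * (if t n = y then 1 else 0))).congr_fun fun x => ?_
    by_cases h : s n = x
    · simp [h]
    · simp [h, Ne.symm h]
  · obtain ⟨n, hn⟩ : ∃ n, w n * (if s n = p.1 then 1 else 0) * (if t n = p.2 then 1 else 0) ≠ 0 := by
      by_contra! hall
      exact hp (by simp only [hall, tsum_zero])
    have h1 : s n = p.1 := by
      by_contra h
      simp [h] at hn
    have h2 : t n = p.2 := by
      by_contra h
      simp [h] at hn
    have h3 : s n ≠ t n := fun h => by simp [hw, h] at hn
    exact h1 ▸ h2 ▸ hst n h3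
  · exact (hasSum_tsum_of_nonneg (F := fun n x => w n * (if s n = x then 1 else 0))
      (c := w) (fun n x => by split_ifs <;> simp [hw0 n])
      (fun n => (hasSum_ite_eq (s n) (w n)).congr_fun fun x => by
        by_cases h : s n = x
        · simp [h]
        · simp [h, Ne.symm h]) hws).2.summable
  · rw [divergence_tsum_pathFlow (fun n => (hγ n).1) hnd h0 hq]
    simp only [hs, ht, Set.indicator_apply, Set.mem_ofPred_eq, Option.some.injEq, Pi.one_apply]
    rw [← (ind h0 hq _).tsum_sub (ind h0 hq _), ← (ind hw0 hws _).tsum_sub (ind hw0 hws _)]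
    congr 1 with n
    by_cases h : s n = t n <;> simp [hw, h]

/-- On an acyclic digraph, a transport plan along the induced strict order is realised by a
finitely decomposable flow. -/
theorem IsPlan.exists_flow [Countable V] [Nonempty V] {E : Set (V × V)}
    (hacyc : AcyclicRel (edgeRel E)) {O I : V → ℝ} {ρ : V × V → ℝ}
    (h : IsPlan (Relation.TransGen (edgeRel E)) O I ρ) :
    ∃ Q, IsFlow E Q ∧ FinDecomposable E Q ∧ ∀ x, divergence Q x = O x - I x := by
  classical
  obtain ⟨v₀⟩ := ‹Nonempty V›
  have hpath : ∀ p : V × V, ∃ l, IsDipath E l ∧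
      (ρ p ≠ 0 → l.head? = some p.1 ∧ l.getLast? = some p.2) := fun p => by
    by_cases hp : ρ p = 0
    · exact ⟨[v₀], ⟨List.cons_ne_nil _ _, List.isChain_singleton _⟩, fun h => absurd hp h⟩
    · obtain ⟨l, hl, hc, h1, h2⟩ :=
        List.exists_isChain_ne_nil_of_relationReflTransGen (h.rel_of_ne_zero p hp).to_reflTransGen
      exact ⟨l, ⟨hl, hc⟩, fun _ => ⟨by rw [List.head?_eq_some_head hl, h1],
        by rw [List.getLast?_eq_some_getLast hl, h2]⟩⟩
  choose l hl hends using hpath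
  obtain ⟨g, hg⟩ := exists_injective_nat (V × V)
  set γ : ℕ → List V := Function.extend g l fun _ => [v₀] with hγdef
  set q : ℕ → ℝ := Function.extend g ρ 0 with hqdef
  have hγg : ∀ p, γ (g p) = l p := hg.extend_apply _ _
  have hqg : ∀ p, q (g p) = ρ p := hg.extend_apply _ _
  have hγ : ∀ n, IsDipath E (γ n) := fun n => by
    by_cases hn : ∃ p, g p = n
    · obtain ⟨p, rfl⟩ := hn
      exact hγg p ▸ hl p
    · rw [hγdef, Function.extend_apply' _ _ _ hn]
      exact ⟨List.cons_ne_nil _ _, List.isChain_singleton _⟩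
  have hq' : ∀ n, n ∉ Set.range g → q n = 0 := fun n hn => by
    rw [hqdef, Function.extend_apply' _ _ _ hn, Pi.zero_apply]
  have h0 : ∀ n, 0 ≤ q n := fun n => by
    by_cases hn : ∃ p, g p = n
    · obtain ⟨p, rfl⟩ := hn
      exact hqg p ▸ h.nonneg p
    · exact (hq' n hn).ge
  have hq : Summable q := (summable_extend_zero hg).2 h.summable
  have hnd : ∀ n, (γ n).Nodup := fun n => edgeRel_isChain_nodup hacyc (hγ n).2
  refine ⟨fun e => ∑' n, q n * pathFlow (γ n) e, ⟨fun e => tsum_nonneg fun n =>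
    mul_nonneg (h0 n) (pathFlow_nonneg _ _), fun e he => ?_⟩,
    ⟨γ, q, hγ, hnd, h0, hq, fun _ => rfl⟩, fun x => ?_⟩
  · have : ∀ n, pathFlow (γ n) e = 0 := fun n =>
      Set.indicator_of_notMem (s := {e | e ∈ pathEdges (γ n)})
        (fun hm => he ((hγ n).pathEdges_subset e hm)) _
    simp only [this, mul_zero, tsum_zero]
  · have hsum : ∀ S : List V → Set V, ∑' n, q n * (S (γ n)).indicator 1 x =
        ∑' p, ρ p * (S (l p)).indicator 1 x := fun S => by
      rw [← hg.tsum_eq (f := fun n => q n * (S (γ n)).indicator 1 x)]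
      · simp only [hγg, hqg]
      · intro n hn
        by_contra hn'
        exact hn (by simp [hq' n hn'])
    rw [divergence_tsum_pathFlow (fun n => (hγ n).1) hnd h0 hq,
      hsum fun m => {y | m.head? = some y}, hsum fun m => {y | m.getLast? = some y},
      ← (h.hasSum_fst_eq x).tsum_eq, ← (h.hasSum_snd_eq x).tsum_eq]
    congr 1
    · congr 1 with p
      by_cases hp : ρ p = 0
      · simp [hp]
      · simp [(hends p hp).1, Set.indicator_apply, eq_comm]
    · congr 1 with p
      by_cases hp : ρ p = 0
      · simp [hp]
      · simp [(hends p hp).2, Set.indicator_apply, eq_comm]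

theorem exists_flow_iff_exists_isPlan [Countable V] [Nonempty V] {E : Set (V × V)}
    (hacyc : AcyclicRel (edgeRel E)) (f : V → ℝ) :
    (∃ Q, IsFlow E Q ∧ FinDecomposable E Q ∧ ∀ x, divergence Q x = f x) ↔
      ∃ O I ρ, IsPlan (Relation.TransGen (edgeRel E)) O I ρ ∧ ∀ x, O x - I x = f x := by
  constructor
  · rintro ⟨Q, -, hQ, hf⟩
    obtain ⟨O, I, ρ, h, hdiv⟩ := hQ.exists_isPlan
    exact ⟨O, I, ρ, h, fun x => (hdiv x).symm.trans (hf x)⟩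
  · rintro ⟨O, I, ρ, h, hf⟩
    obtain ⟨Q, hQ, hQd, hdiv⟩ := h.exists_flow hacyc
    exact ⟨Q, hQ, hQd, fun x => (hdiv x).trans (hf x)⟩

/-! ### Closedness -/

/-- A sequence of transport plans with dominated marginals has a cluster point for pointwise
convergence which is again a transport plan. -/
theorem exists_isPlan_of_dominated {r : V → V → Prop} {O I : ℕ → V → ℝ} {ρ : ℕ → V × V → ℝ}
    {G f : V → ℝ} (h : ∀ k, IsPlan r (O k) (I k) (ρ k)) (hG : Summable G)
    (hO : ∀ k x, O k x ≤ G x) (hI : ∀ k x, I k x ≤ G x)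
    (hf : ∀ x, Filter.Tendsto (fun k => O k x - I k x) Filter.atTop (nhds (f x))) :
    ∃ O' I' ρ', IsPlan r O' I' ρ' ∧ ∀ x, O' x - I' x = f x := by
  let U : Ultrafilter ℕ := Filter.hyperfilter ℕ
  have hU : (U : Filter ℕ) ≤ Filter.atTop := Nat.hyperfilter_le_atTop
  have hcl : ∀ p, ∃ c, Filter.Tendsto (fun k => ρ k p) U (nhds c) := fun p => by
    obtain ⟨c, -, hc⟩ := (isCompact_Icc (a := (0 : ℝ)) (b := G p.1)).ultrafilter_le_nhds
      (U.map fun k => ρ k p) (by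
        rw [Filter.le_principal_iff, Ultrafilter.mem_coe, Ultrafilter.mem_map]
        exact Filter.Eventually.of_forall (f := (U : Filter ℕ)) fun k =>
          ⟨(h k).nonneg p, ((h k).le_left p).trans (hO k p.1)⟩)
    exact ⟨c, hc⟩
  choose ρ' hρ' using hcl
  have h0 : ∀ p, 0 ≤ ρ' p := fun p => ge_of_tendsto' (hρ' p) fun k => (h k).nonneg p
  have hle1 : ∀ p, ρ' p ≤ G p.1 := fun p =>
    le_of_tendsto' (hρ' p) fun k => ((h k).le_left p).trans (hO k p.1)
  have hle2 : ∀ p, ρ' p ≤ G p.2 := fun p =>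
    le_of_tendsto' (hρ' p) fun k => ((h k).le_right p).trans (hI k p.2)
  have hOt : ∀ x, Filter.Tendsto (fun k => O k x) U (nhds (∑' y, ρ' (x, y))) := fun x => by
    simp only [← ((h _).hasSum_row x).tsum_eq]
    refine tendsto_tsum_of_dominated_convergence hG (fun y => hρ' (x, y))
      (Filter.Eventually.of_forall fun k y => ?_)
    rw [Real.norm_of_nonneg ((h k).nonneg _)]
    exact ((h k).le_right _).trans (hI k y)
  have hIt : ∀ y, Filter.Tendsto (fun k => I k y) U (nhds (∑' x, ρ' (x, y))) := fun y => by
    simp only [← ((h _).hasSum_col y).tsum_eq]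
    refine tendsto_tsum_of_dominated_convergence hG (fun x => hρ' (x, y))
      (Filter.Eventually.of_forall fun k x => ?_)
    rw [Real.norm_of_nonneg ((h k).nonneg _)]
    exact ((h k).le_left _).trans (hO k x)
  refine ⟨fun x => ∑' y, ρ' (x, y), fun y => ∑' x, ρ' (x, y), ρ', ⟨⟨h0, fun x => ?_, fun y => ?_⟩,
    fun p hp => ?_, ?_⟩, fun x => ?_⟩
  · exact (hG.of_nonneg_of_le (fun _ => h0 _) fun y => hle2 (x, y)).hasSum
  · exact (hG.of_nonneg_of_le (fun _ => h0 _) fun x => hle1 (x, y)).hasSum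
  · by_contra hr
    have hz : ∀ k, ρ k p = 0 := fun k => by
      by_contra hne
      exact hr ((h k).rel_of_ne_zero p hne)
    refine hp (tendsto_nhds_unique (hρ' p) ?_)
    simp only [hz]
    exact tendsto_const_nhds
  · exact hG.of_nonneg_of_le (fun _ => tsum_nonneg fun _ => h0 _) fun x =>
      le_of_tendsto' (hOt x) fun k => hO k x
  · exact tendsto_nhds_unique ((hOt x).sub (hIt x)) ((hf x).mono_left hU)

theorem lp_one_hasSum_abs (f : lp (fun _ : V => ℝ) 1) : HasSum (fun x => |f x|) ‖f‖ := by
  simpa using lp.hasSum_norm (by simp) f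

/-- Marginal differences of plans of finite mass along a strict order form an `ℓ¹`-closed set. -/
theorem isClosed_setOf_exists_isPlan {r : V → V → Prop} (hirr : ∀ x, ¬ r x x)
    (htr : ∀ x y z, r x y → r y z → r x z) :
    IsClosed {f : lp (fun _ : V => ℝ) 1 |
      ∃ O I ρ, IsPlan r O I ρ ∧ ∀ x, O x - I x = f x} := by
  refine IsSeqClosed.isClosed fun u f hu huf => ?_
  have hε : ∀ k : ℕ, (0 : ℝ) < (1 / 2) ^ k := fun k => by positivity
  obtain ⟨φ, -, hφ⟩ := Filter.extraction_forall_of_eventually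
    (P := fun k n => ‖u n - f‖ < (1 / 2) ^ k)
    fun k => (tendsto_iff_norm_sub_tendsto_zero.1 huf).eventually (gt_mem_nhds (hε k))
  have hplan : ∀ k, ∃ O I ρ, IsPlan r O I ρ ∧ (∀ x, O x - I x = u (φ k) x) ∧
      ∑' x, min (O x) (I x) ≤ (1 / 2) ^ k := fun k => by
    obtain ⟨O, I, ρ, h, hd⟩ := hu (φ k)
    obtain ⟨O', I', ρ', h', hd', hm⟩ := h.exists_tsum_min_le hirr htr (hε k)
    exact ⟨O', I', ρ', h', fun x => (hd' x).trans (hd x), hm⟩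
  choose O I ρ h hd hm using hplan
  have hmin0 : ∀ k x, 0 ≤ min (O k x) (I k x) := fun k x =>
    le_min ((h k).left_nonneg x) ((h k).right_nonneg x)
  have hF := hasSum_tsum_of_nonneg
    (F := fun k x => |(u (φ k) - f) x| + min (O k x) (I k x))
    (c := fun k => ‖u (φ k) - f‖ + ∑' x, min (O k x) (I k x))
    (fun k x => add_nonneg (abs_nonneg _) (hmin0 k x))
    (fun k => (lp_one_hasSum_abs _).add (h k).summable_min.hasSum)
    (Summable.add (summable_geometric_two.of_nonneg_of_le (fun _ => norm_nonneg _)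
        fun k => (hφ k).le)
      (summable_geometric_two.of_nonneg_of_le (fun k => tsum_nonneg (hmin0 k)) hm))
  have hG : Summable fun x => |f x| + ∑' k, (|(u (φ k) - f) x| + min (O k x) (I k x)) :=
    (lp_one_hasSum_abs f).summable.add hF.2.summable
  have hle : ∀ k x, |u (φ k) x| + min (O k x) (I k x) ≤
      |f x| + ∑' k, (|(u (φ k) - f) x| + min (O k x) (I k x)) := fun k x => by
    have h1 := (hF.1 x).le_tsum k fun j _ => add_nonneg (abs_nonneg _) (hmin0 j x)
    have h2 : |u (φ k) x| ≤ |f x| + |(u (φ k) - f) x| := by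
      have := abs_add_le (f x) (u (φ k) x - f x)
      rwa [add_sub_cancel] at this
    linarith
  refine exists_isPlan_of_dominated h hG (fun k x => le_trans ?_ (hle k x))
    (fun k x => le_trans ?_ (hle k x)) fun x => ?_
  · rw [← hd k x]
    rcases le_total (O k x) (I k x) with hc | hc
    · simp [min_eq_left hc]
    · rw [min_eq_right hc]
      linarith [le_abs_self (O k x - I k x)]
  · rw [← hd k x]
    rcases le_total (O k x) (I k x) with hc | hc
    · rw [min_eq_left hc]
      linarith [neg_abs_le (O k x - I k x)]
    · simp [min_eq_right hc]
  · simp only [hd]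
    rw [tendsto_iff_norm_sub_tendsto_zero]
    refine squeeze_zero (fun _ => norm_nonneg _) (fun k => ?_)
      (tendsto_pow_atTop_nhds_zero_of_lt_one (r := (1 / 2 : ℝ)) (by norm_num) (by norm_num))
    exact (lp.norm_apply_le_norm one_ne_zero (u (φ k) - f) x).trans (hφ k).le

/-- **The set of divergences of finitely decomposable flows is convex and ℓ¹-closed.** -/
theorem divergences_convex_closed {V : Type*} [Countable V]
    (E : Set (V × V)) (hloop : ∀ x : V, (x, x) ∉ E) (hacyc : AcyclicRel (edgeRel E)) :
    Convex ℝ {f : lp (fun _ : V => ℝ) 1 | ∃ Q : V × V → ℝ,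
        IsFlow E Q ∧ FinDecomposable E Q ∧ ∀ x, divergence Q x = f x} ∧
    IsClosed {f : lp (fun _ : V => ℝ) 1 | ∃ Q : V × V → ℝ,
        IsFlow E Q ∧ FinDecomposable E Q ∧ ∀ x, divergence Q x = f x} := by
  rcases isEmpty_or_nonempty V with hV | hV
  · have hempty : {f : lp (fun _ : V => ℝ) 1 | ∃ Q : V × V → ℝ,
        IsFlow E Q ∧ FinDecomposable E Q ∧ ∀ x, divergence Q x = f x} = ∅ := by
      refine Set.eq_empty_of_forall_notMem fun f => ?_
      rintro ⟨Q, -, ⟨γ, -, hγ, -⟩, -⟩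
      exact hV.false ((γ 0).head (hγ 0).1)
    rw [hempty]
    exact ⟨convex_empty, isClosed_empty⟩
  · simp only [exists_flow_iff_exists_isPlan hacyc]
    refine ⟨?_, isClosed_setOf_exists_isPlan hacyc fun _ _ _ => Relation.TransGen.trans⟩
    rintro f ⟨O, I, ρ, h, hf⟩ f' ⟨O', I', ρ', h', hf'⟩ a b ha hb -
    refine ⟨_, _, _, h.smul_add_smul h' ha hb, fun x => ?_⟩
    simp only [lp.coeFn_add, lp.coeFn_smul, Pi.add_apply, Pi.smul_apply, smul_eq_mul, ← hf, ← hf']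
    ring
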